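/- Let A be a real m×n matrix, b ∈ ℝ^m, B a real s×n matrix, d ∈ ℝ^s, λ > 0, σ > 0, and fix x ∈ ℝⁿ. Let W = {w ∈ ℝⁿ : ‖w‖∞ ≤ λ} and L_σ(u,v,w;x) = (1/2)‖u‖² + ⟨b,u⟩ − ⟨d,v⟩ − ⟨x, Aᵀu − Bᵀv + w⟩ + (σ/2)‖Aᵀu − Bᵀv + w‖². Then for every (u, v) ∈ ℝ^m × ℝ^s, the infimum of w ↦ L_σ(u,v,w;x) over W equals θ(u,v) := (1/2)‖u‖² + ⟨b,u⟩ − ⟨d,v⟩ + (1/(2σ))‖S_{σλ}(x − σ(Aᵀu − Bᵀv))‖² − (1/(2σ))‖x‖², and the infimum is attained at the unique point w̃ = Π_W(x/σ − (Aᵀu − Bᵀv)), the Euclidean projection of x/σ − (Aᵀu − Bᵀv) onto W (componentwise clipping to [−λ, λ]). -/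

import Mathlib

open Matrix

/-- Euclidean norm on `Fin n → ℝ`. -/
noncomputable def euclNorm {n : ℕ} (x : Fin n → ℝ) : ℝ := Real.sqrt (∑ i, x i ^ 2)

/-- Euclidean inner product on `Fin n → ℝ`. -/
def dotp {n : ℕ} (x y : Fin n → ℝ) : ℝ := ∑ i, x i * y i

/-- ℓ₁ norm on `Fin n → ℝ`. -/
def l1norm {n : ℕ} (x : Fin n → ℝ) : ℝ := ∑ i, |x i|

/-- Euclidean distance from a point to a set: `inf_{y ∈ S} ‖x − y‖`. -/
noncomputable def distSet {n : ℕ} (x : Fin n → ℝ) (S : Set (Fin n → ℝ)) : ℝ :=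
  sInf ((fun y => euclNorm (x - y)) '' S)

/-- Subdifferential of a (convex) function `g` at `x`. -/
def subdiff {n : ℕ} (g : (Fin n → ℝ) → ℝ) (x : Fin n → ℝ) : Set (Fin n → ℝ) :=
  {s : Fin n → ℝ | ∀ y, g y ≥ g x + dotp s (y - x)}

/-- Soft-thresholding operator with parameter `τ`:
`(S_τ z)ᵢ = sign(zᵢ) · max(|zᵢ| − τ, 0)`; the proximal mapping of `τ‖·‖₁`. -/
noncomputable def softThresh {n : ℕ} (τ : ℝ) (z : Fin n → ℝ) : Fin n → ℝ :=
  fun i => Real.sign (z i) * max (|z i| - τ) 0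

/-- Componentwise clipping to `[−λ, λ]`, the Euclidean projection onto
`W = {w : ‖w‖∞ ≤ λ}`. -/
def clipW {n : ℕ} (lam : ℝ) (z : Fin n → ℝ) : Fin n → ℝ :=
  fun i => max (-lam) (min lam (z i))

theorem euclNorm_nonneg {n : ℕ} (x : Fin n → ℝ) : 0 ≤ euclNorm x :=
  Real.sqrt_nonneg _

theorem euclNorm_sq {n : ℕ} (x : Fin n → ℝ) : euclNorm x ^ 2 = ∑ i, x i ^ 2 :=
  Real.sq_sqrt (Finset.sum_nonneg fun _ _ => sq_nonneg _)

theorem euclNorm_smul_sq {n : ℕ} (a : ℝ) (x : Fin n → ℝ) :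
    euclNorm (a • x) ^ 2 = a ^ 2 * euclNorm x ^ 2 := by
  simp only [euclNorm_sq, Pi.smul_apply, smul_eq_mul, mul_pow, Finset.mul_sum]

theorem euclNorm_sub_eq_zero_iff {n : ℕ} {x y : Fin n → ℝ} : euclNorm (x - y) = 0 ↔ x = y := by
  rw [← sq_eq_zero_iff, euclNorm_sq, Finset.sum_eq_zero_iff_of_nonneg fun _ _ => sq_nonneg _]
  simp [sub_eq_zero, funext_iff]

theorem abs_clipW_le {n : ℕ} {lam : ℝ} (hlam : 0 ≤ lam) (z : Fin n → ℝ) (i : Fin n) :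
    |clipW lam z i| ≤ lam :=
  abs_le.2 ⟨le_max_left _ _, max_le (by linarith) (min_le_left _ _)⟩

/-- Strong form of the projection inequality for the clipping onto the box. -/
theorem euclNorm_sub_clipW_sq_add_le {n : ℕ} {lam : ℝ} (z : Fin n → ℝ)
    {w : Fin n → ℝ} (hw : ∀ i, |w i| ≤ lam) :
    euclNorm (z - clipW lam z) ^ 2 + euclNorm (w - clipW lam z) ^ 2 ≤ euclNorm (z - w) ^ 2 := by
  simp only [euclNorm_sq, ← Finset.sum_add_distrib]
  refine Finset.sum_le_sum fun i _ => ?_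
  obtain ⟨h₁, h₂⟩ := abs_le.1 (hw i)
  simp only [Pi.sub_apply, clipW]
  rcases le_total lam (z i) with h | h
  · rw [min_eq_left h, max_eq_right (by linarith)]
    nlinarith [mul_nonneg (sub_nonneg.2 h) (sub_nonneg.2 h₂)]
  · rw [min_eq_right h]
    rcases le_total (-lam) (z i) with h' | h'
    · rw [max_eq_right h']
      nlinarith
    · rw [max_eq_left h']
      nlinarith [mul_nonneg (sub_nonneg.2 h') (sub_nonneg.2 h₁)]

/-- Moreau decomposition: soft-thresholding is the residual of the clipping. -/
theorem softThresh_smul {n : ℕ} {lam σ : ℝ} (hlam : 0 < lam) (hσ : 0 < σ) (z : Fin n → ℝ) :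
    softThresh (σ * lam) (σ • z) = σ • (z - clipW lam z) := by
  funext i
  simp only [softThresh, clipW, Pi.smul_apply, Pi.sub_apply, smul_eq_mul]
  rw [abs_mul, abs_of_pos hσ, ← mul_sub]
  rcases le_total lam (z i) with h | h
  · have hz : 0 < z i := hlam.trans_le h
    rw [min_eq_left h, max_eq_right (neg_le_self hlam.le), Real.sign_of_pos (mul_pos hσ hz),
      abs_of_pos hz, max_eq_left (mul_nonneg hσ.le (sub_nonneg.2 h)), one_mul]
  · rw [min_eq_right h]
    rcases le_total (-lam) (z i) with h' | h'
    · rw [max_eq_right h', max_eq_right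
        (mul_nonpos_of_nonneg_of_nonpos hσ.le (sub_nonpos.2 (abs_le.2 ⟨h', h⟩)))]
      ring
    · have hz : z i < 0 := by linarith
      rw [max_eq_left h', Real.sign_of_neg (mul_neg_of_pos_of_neg hσ hz), abs_of_neg hz,
        max_eq_left (mul_nonneg hσ.le (by linarith))]
      ring

theorem neg_dotp_add_euclNorm_sq {n : ℕ} {σ : ℝ} (hσ : σ ≠ 0) (x c w : Fin n → ℝ) :
    -dotp x (c + w) + (σ / 2) * euclNorm (c + w) ^ 2 =
      (σ / 2) * euclNorm (σ⁻¹ • x - c - w) ^ 2 - (1 / (2 * σ)) * euclNorm x ^ 2 := by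
  simp only [euclNorm_sq, dotp, Finset.mul_sum, ← Finset.sum_neg_distrib,
    ← Finset.sum_add_distrib, ← Finset.sum_sub_distrib]
  refine Finset.sum_congr rfl fun i _ => ?_
  simp only [Pi.add_apply, Pi.sub_apply, Pi.smul_apply, smul_eq_mul]
  field_simp
  ring

/-- **Partial minimization of the augmented Lagrangian in `w`**: for each `(u,v)`,
the infimum of `w ↦ L_σ(u,v,w;x)` over `W = {w : ‖w‖∞ ≤ λ}` equals
`θ(u,v) = (1/2)‖u‖² + ⟨b,u⟩ − ⟨d,v⟩ + (1/(2σ))‖S_{σλ}(x − σ(Aᵀu − Bᵀv))‖² − (1/(2σ))‖x‖²`,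
attained at the unique point `w̃ = Π_W(x/σ − (Aᵀu − Bᵀv))`, the Euclidean projection
(componentwise clipping) of `x/σ − (Aᵀu − Bᵀv)` onto `W`. -/
theorem aug_lagrangian_partial_min_in_w
    {m n s : ℕ} (A : Matrix (Fin m) (Fin n) ℝ) (b : Fin m → ℝ)
    (B : Matrix (Fin s) (Fin n) ℝ) (d : Fin s → ℝ)
    (lam σ : ℝ) (hlam : 0 < lam) (hσ : 0 < σ)
    (x : Fin n → ℝ)
    (L : (Fin m → ℝ) → (Fin s → ℝ) → (Fin n → ℝ) → ℝ)
    (hL : L = fun u v w =>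
      (1 / 2) * euclNorm u ^ 2 + dotp b u - dotp d v
        - dotp x (Aᵀ *ᵥ u - Bᵀ *ᵥ v + w)
        + (σ / 2) * euclNorm (Aᵀ *ᵥ u - Bᵀ *ᵥ v + w) ^ 2)
    (θ : (Fin m → ℝ) → (Fin s → ℝ) → ℝ)
    (hθ : θ = fun u v =>
      (1 / 2) * euclNorm u ^ 2 + dotp b u - dotp d v
        + (1 / (2 * σ))
            * euclNorm (softThresh (σ * lam) (x - σ • (Aᵀ *ᵥ u - Bᵀ *ᵥ v))) ^ 2
        - (1 / (2 * σ)) * euclNorm x ^ 2) :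
    ∀ (u : Fin m → ℝ) (v : Fin s → ℝ),
      (∀ i, |clipW lam (σ⁻¹ • x - (Aᵀ *ᵥ u - Bᵀ *ᵥ v)) i| ≤ lam) ∧
      L u v (clipW lam (σ⁻¹ • x - (Aᵀ *ᵥ u - Bᵀ *ᵥ v))) = θ u v ∧
      (∀ w : Fin n → ℝ, (∀ i, |w i| ≤ lam) → θ u v ≤ L u v w) ∧
      (∀ w : Fin n → ℝ, (∀ i, |w i| ≤ lam) → L u v w = θ u v →
        w = clipW lam (σ⁻¹ • x - (Aᵀ *ᵥ u - Bᵀ *ᵥ v))) ∧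
      (∀ w : Fin n → ℝ, (∀ i, |w i| ≤ lam) →
        euclNorm ((σ⁻¹ • x - (Aᵀ *ᵥ u - Bᵀ *ᵥ v))
            - clipW lam (σ⁻¹ • x - (Aᵀ *ᵥ u - Bᵀ *ᵥ v)))
          ≤ euclNorm ((σ⁻¹ • x - (Aᵀ *ᵥ u - Bᵀ *ᵥ v)) - w)) := by
  intro u v
  set c := Aᵀ *ᵥ u - Bᵀ *ᵥ v with hc
  set z := σ⁻¹ • x - c with hz
  have hθL (w : Fin n → ℝ) : L u v w - θ u v =
      (σ / 2) * (euclNorm (z - w) ^ 2 - euclNorm (z - clipW lam z) ^ 2) := by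
    have hxz : x - σ • c = σ • z := by
      rw [hz, smul_sub σ (σ⁻¹ • x) c, smul_inv_smul₀ hσ.ne']
    have hS : (1 / (2 * σ)) * euclNorm (softThresh (σ * lam) (x - σ • c)) ^ 2 =
        (σ / 2) * euclNorm (z - clipW lam z) ^ 2 := by
      rw [hxz, softThresh_smul hlam hσ, euclNorm_smul_sq]
      field_simp
    have hsq := neg_dotp_add_euclNorm_sq hσ.ne' x c w
    simp only [hL, hθ, ← hc, hS]
    linarith
  have hgap (w : Fin n → ℝ) (hw : ∀ i, |w i| ≤ lam) :
      (σ / 2) * euclNorm (w - clipW lam z) ^ 2 ≤ L u v w - θ u v := by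
    rw [hθL]
    exact mul_le_mul_of_nonneg_left
      (by linarith [euclNorm_sub_clipW_sq_add_le z hw]) (half_pos hσ).le
  refine ⟨abs_clipW_le hlam.le z, ?_, fun w hw => ?_, fun w hw h => ?_, fun w hw => ?_⟩
  · have := hθL (clipW lam z)
    rw [sub_self, mul_zero] at this
    linarith
  · have : 0 ≤ (σ / 2) * euclNorm (w - clipW lam z) ^ 2 := by positivity
    linarith [hgap w hw]
  · have h₀ := hgap w hw
    rw [h, sub_self] at h₀
    exact euclNorm_sub_eq_zero_iff.1 <| pow_eq_zero_iff two_ne_zero |>.1 <|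
      le_antisymm (nonpos_of_mul_nonpos_right h₀ (half_pos hσ)) (sq_nonneg _)
  · refine (sq_le_sq₀ (euclNorm_nonneg _) (euclNorm_nonneg _)).1 ?_
    linarith [euclNorm_sub_clipW_sq_add_le z hw, sq_nonneg (euclNorm (w - clipW lam z))]
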